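/- Fix l ≥ 1, let Σ_S be given by an asynchronous state space system B_S of trajectories ℕ → Γ × X with external behavior B, and let Σ_S^{l↑} be the canonical state space system for B^{l↑}. If B = B^{l↑} and R_X is an l-initial simulation relation from Σ_S to Σ_S, then Σ_S and Σ_S^{l↑} are l-initially bisimilar: there exists a relation R ⊆ X × Z' (namely R = R_l) such that R is an l-initial simulation relation from Σ_S to Σ_S^{l↑} and R^{-1} is an l-initial simulation relation from Σ_S^{l↑} to Σ_S. -/

import Mathlib

namespace LComplete

/-- The string `(γ s, γ (s+1), …, γ (s+len-1))`, i.e. the restriction `γ|[s, s+len-1]`. -/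
def window {Γ : Type*} (γ : ℕ → Γ) (s len : ℕ) : List Γ :=
  (List.range len).map fun i => γ (s + i)

/-- The set of restrictions `B|[s, s+len-1]` of all signals in the behavior `B`. -/
def windowSet {Γ : Type*} (B : Set (ℕ → Γ)) (s len : ℕ) : Set (List Γ) :=
  (fun γ => window γ s len) '' B

/-- `(Γ, B)` is asynchronously `m`-complete: a signal belongs to `B` iff its initial
string of length `m` is an initial string of `B` and every sliding window of length
`m+1` occurs somewhere in `B`. -/
def AsyncComplete {Γ : Type*} (m : ℕ) (B : Set (ℕ → Γ)) : Prop :=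
  ∀ γ : ℕ → Γ,
    γ ∈ B ↔ (window γ 0 m ∈ windowSet B 0 m ∧
      ∀ k : ℕ, ∃ k' : ℕ, window γ k (m + 1) ∈ windowSet B k' (m + 1))

/-- The behavior `B^{m↑}` of the strongest asynchronous `m`-complete approximation. -/
def lift {Γ : Type*} (m : ℕ) (B : Set (ℕ → Γ)) : Set (ℕ → Γ) :=
  { γ | window γ 0 m ∈ windowSet B 0 m ∧
      ∀ k : ℕ, ∃ k' : ℕ, window γ k (m + 1) ∈ windowSet B k' (m + 1) }

/-- The concatenation `w₁ ∧_{t₁}^{t₂} w₂`. -/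
def concat {V : Type*} (w₁ w₂ : ℕ → V) (t₁ t₂ : ℕ) : ℕ → V :=
  fun t => if t < t₁ then w₁ t else w₂ (t - t₁ + t₂)

/-- `BS` is an asynchronous state space system. -/
def IsAsyncSS {W X : Type*} (BS : Set ((ℕ → W) × (ℕ → X))) : Prop :=
  ∀ p ∈ BS, ∀ q ∈ BS, ∀ t₁ t₂ : ℕ, p.2 t₁ = q.2 t₂ →
    (concat p.1 q.1 t₁ t₂, concat p.2 q.2 t₁ t₂) ∈ BS

/-- State set `Z'` of the canonical state space system for `B'`. -/
def canonState {Γ : Type*} (l : ℕ) (B' : Set (ℕ → Γ)) : Set (List Γ) :=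
  { ζ | (ζ.length < l ∧ ζ ∈ windowSet B' 0 ζ.length) ∨
        (ζ.length = l ∧ ∃ k : ℕ, ζ ∈ windowSet B' k l) }

/-- Behavior `B'_S` of the canonical state space system for `B'`. -/
def canonBeh {Γ : Type*} (l : ℕ) (B' : Set (ℕ → Γ)) :
    Set ((ℕ → Γ) × (ℕ → List Γ)) :=
  { p | p.1 ∈ B' ∧
      ∀ k : ℕ, p.2 k = if k < l then window p.1 0 k else window p.1 (k - l) l }

/-- The external behavior of a state space behavior. -/
def extBeh {Γ X : Type*} (BS : Set ((ℕ → Γ) × (ℕ → X))) : Set (ℕ → Γ) :=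
  { γ | ∃ x : ℕ → X, (γ, x) ∈ BS }

/-- `R` is an `m`-initial simulation relation from the system with behavior `BS₁`
to the system with behavior `BS₂`. -/
def InitSim {Γ X₁ X₂ : Type*} (m : ℕ) (BS₁ : Set ((ℕ → Γ) × (ℕ → X₁)))
    (BS₂ : Set ((ℕ → Γ) × (ℕ → X₂))) (R : Set (X₁ × X₂)) : Prop :=
  (∀ p ∈ BS₁, ∃ q ∈ BS₂, (p.2 m, q.2 m) ∈ R) ∧
  (∀ p ∈ BS₁, ∀ q' ∈ BS₂, ∀ t₁ t₂ : ℕ, (p.2 t₁, q'.2 t₂) ∈ R →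
    ∃ q ∈ BS₂,
      q.1 = concat q'.1 p.1 t₂ t₁ ∧
      (∀ t ≤ t₂, q.2 t = q'.2 t) ∧
      ∀ j : ℕ, 1 ≤ j → (p.2 (t₁ + j), q.2 (t₂ + j)) ∈ R)

/-- `R` is a synchronous simulation relation from the system with behavior `BS₁`
to the system with behavior `BS₂`. -/
def SyncSim {Γ X₁ X₂ : Type*} (BS₁ : Set ((ℕ → Γ) × (ℕ → X₁)))
    (BS₂ : Set ((ℕ → Γ) × (ℕ → X₂))) (R : Set (X₁ × X₂)) : Prop :=
  (∀ t : ℕ, ∀ p ∈ BS₁, ∃ q ∈ BS₂, (p.2 t, q.2 t) ∈ R) ∧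
  (∀ p ∈ BS₁, ∀ q' ∈ BS₂, ∀ t : ℕ, (p.2 t, q'.2 t) ∈ R →
    ∃ q ∈ BS₂,
      q.1 = concat q'.1 p.1 t t ∧
      (∀ s ≤ t, q.2 s = q'.2 s) ∧
      ∀ j : ℕ, 1 ≤ j → (p.2 (t + j), q.2 (t + j)) ∈ R)

/-- `X^{k,ζ}`: states reached at time `k` with recent past `ζ`. -/
def reachAt {Γ X : Type*} (BS : Set ((ℕ → Γ) × (ℕ → X))) (k : ℕ) (ζ : List Γ) :
    Set X :=
  { ξ | ∃ p ∈ BS, p.2 k = ξ ∧ window p.1 (k - ζ.length) ζ.length = ζ }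

/-- `X_ζ`: states compatible with recent past `ζ`. -/
def reach {Γ X : Type*} (BS : Set ((ℕ → Γ) × (ℕ → X))) (ζ : List Γ) : Set X :=
  { ξ | ∃ k : ℕ, ζ.length ≤ k ∧ ξ ∈ reachAt BS k ζ }

/-- The relation `R₀ ⊆ X × Z'`. -/
def R0 {Γ X : Type*} (l : ℕ) (BS : Set ((ℕ → Γ) × (ℕ → X))) (B : Set (ℕ → Γ)) :
    Set (X × List Γ) :=
  { p | p.2 ∈ canonState l (lift l B) ∧
      ((p.2.length < l ∧ p.1 ∈ reachAt BS p.2.length p.2) ∨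
       (p.2.length = l ∧ p.1 ∈ reach BS p.2)) }

/-- The relation `R_l ⊆ X × Z'`. -/
def Rl {Γ X : Type*} (l : ℕ) (BS : Set ((ℕ → Γ) × (ℕ → X))) (B : Set (ℕ → Γ)) :
    Set (X × List Γ) :=
  { p | p.2 ∈ canonState l (lift l B) ∧ p.2.length = l ∧ p.1 ∈ reach BS p.2 }

/-- The relation `R_X ⊆ X × X`. -/
def RX {Γ X : Type*} (l : ℕ) (BS : Set ((ℕ → Γ) × (ℕ → X))) : Set (X × X) :=
  { p | ∃ ζ : List Γ, ζ.length = l ∧ p.1 ∈ reach BS ζ ∧ p.2 ∈ reach BS ζ }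

/-- The inverse of a relation. -/
def inv {X₁ X₂ : Type*} (R : Set (X₁ × X₂)) : Set (X₂ × X₁) :=
  { p | (p.2, p.1) ∈ R }

/-- The full behavior `B_f(P)` of a state machine `P = (X, W, δ, X₀)`. -/
def fullBeh {W X : Type*} (δ : Set (X × W × X)) (X₀ : Set X) :
    Set ((ℕ → W) × (ℕ → X)) :=
  { p | p.2 0 ∈ X₀ ∧ ∀ t : ℕ, (p.2 t, p.1 t, p.2 (t + 1)) ∈ δ }

/-- The transition relation `δ` of the canonical realization of `B'`. -/
def canonDelta {Γ : Type*} (l : ℕ) (B' : Set (ℕ → Γ)) :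
    Set (List Γ × Γ × List Γ) :=
  { t | (t.1.length < l ∧ t.2.2 = t.1 ++ [t.2.1] ∧
          t.1 ++ [t.2.1] ∈ windowSet B' 0 (t.1.length + 1)) ∨
        (t.1.length = l ∧ t.2.2 = t.1.tail ++ [t.2.1] ∧
          ∃ k' : ℕ, t.1 ++ [t.2.1] ∈ windowSet B' k' (l + 1)) }

end LComplete

namespace LComplete

theorem length_window {Γ : Type*} (γ : ℕ → Γ) (s n : ℕ) : (window γ s n).length = n := by
  simp [window]

theorem window_eq_window_iff {Γ : Type*} {γ γ' : ℕ → Γ} {s s' n : ℕ} :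
    window γ s n = window γ' s' n ↔ ∀ i < n, γ (s + i) = γ' (s' + i) := by
  simp [window]

/-- The state trajectory of the canonical state space system driven by `γ`. -/
def canonTraj {Γ : Type*} (l : ℕ) (γ : ℕ → Γ) (k : ℕ) : List Γ :=
  if k < l then window γ 0 k else window γ (k - l) l

theorem canonTraj_of_le {Γ : Type*} {l k : ℕ} (γ : ℕ → Γ) (h : l ≤ k) :
    canonTraj l γ k = window γ (k - l) l :=
  if_neg (by omega)

theorem le_of_length_canonTraj {Γ : Type*} {l k : ℕ} {γ : ℕ → Γ}
    (h : (canonTraj l γ k).length = l) : l ≤ k := by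
  by_contra hk
  rw [canonTraj, if_pos (by omega), length_window] at h
  omega

theorem canonTraj_congr {Γ : Type*} {l k : ℕ} {γ γ' : ℕ → Γ} (h : ∀ i < k, γ i = γ' i) :
    canonTraj l γ k = canonTraj l γ' k := by
  unfold canonTraj
  split_ifs <;> exact window_eq_window_iff.2 fun i hi => h _ (by omega)

theorem mem_canonBeh_iff {Γ : Type*} {l : ℕ} {B : Set (ℕ → Γ)} {γ : ℕ → Γ} {z : ℕ → List Γ} :
    (γ, z) ∈ canonBeh l B ↔ γ ∈ B ∧ z = canonTraj l γ :=
  and_congr_right fun _ => funext_iff.symm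

theorem concat_of_lt {V : Type*} {w₁ w₂ : ℕ → V} {t₁ t₂ t : ℕ} (h : t < t₁) :
    concat w₁ w₂ t₁ t₂ t = w₁ t :=
  if_pos h

theorem concat_add {V : Type*} (w₁ w₂ : ℕ → V) (t₁ t₂ j : ℕ) :
    concat w₁ w₂ t₁ t₂ (t₁ + j) = w₂ (t₂ + j) := by
  simp [concat, Nat.add_comm]

theorem concat_eq_of_le {V : Type*} {w₁ w₂ : ℕ → V} {t₁ t₂ t : ℕ} (h : t₁ ≤ t) :
    concat w₁ w₂ t₁ t₂ t = w₂ (t - t₁ + t₂) :=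
  if_neg (by omega)

/-- Two concatenations with the same continuation agree, up to a time shift, from `l` steps
before the switching times on, provided their last `l` symbols before switching agree. -/
theorem concat_add_eq_concat_add {V : Type*} {u v w : ℕ → V} {a b c l : ℕ}
    (h : window u a l = window v b l) (i : ℕ) :
    concat u w (a + l) c (a + i) = concat v w (b + l) c (b + i) := by
  rw [window_eq_window_iff] at h
  rcases lt_or_ge i l with hi | hi
  · rw [concat_of_lt (by omega), concat_of_lt (by omega), h i hi]
  · rw [concat_eq_of_le (by omega), concat_eq_of_le (by omega)]
    congr 1
    omega

theorem window_mem_reach {Γ X : Type*} {BS : Set ((ℕ → Γ) × (ℕ → X))}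
    {γ : ℕ → Γ} {x : ℕ → X} (h : (γ, x) ∈ BS) (k l : ℕ) :
    x (k + l) ∈ reach BS (window γ k l) := by
  refine ⟨k + l, by simp [length_window], _, h, rfl, ?_⟩
  simp [length_window]

theorem exists_of_mem_reach {Γ X : Type*} {BS : Set ((ℕ → Γ) × (ℕ → X))} {ζ : List Γ}
    {ξ : X} (h : ξ ∈ reach BS ζ) :
    ∃ p ∈ BS, ∃ k, p.2 (k + ζ.length) = ξ ∧ window p.1 k ζ.length = ζ := by
  obtain ⟨k, hk, p, hp, hx, hw⟩ := h
  exact ⟨p, hp, k - ζ.length, by rwa [Nat.sub_add_cancel hk], hw⟩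

theorem window_mem_canonState {Γ : Type*} {l : ℕ} {B : Set (ℕ → Γ)} {γ : ℕ → Γ}
    (h : γ ∈ B) (k : ℕ) : window γ k l ∈ canonState l B :=
  Or.inr ⟨length_window _ _ _, k, γ, h, rfl⟩

theorem mem_Rl_window {Γ X : Type*} {l : ℕ} {BS : Set ((ℕ → Γ) × (ℕ → X))} {B : Set (ℕ → Γ)}
    {γ : ℕ → Γ} {k : ℕ} {ξ : X} (hγ : γ ∈ lift l B) (h : ξ ∈ reach BS (window γ k l)) :
    (ξ, window γ k l) ∈ Rl l BS B :=
  ⟨window_mem_canonState hγ k, length_window _ _ _, h⟩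

theorem subset_lift {Γ : Type*} (l : ℕ) (B : Set (ℕ → Γ)) : B ⊆ lift l B :=
  fun γ h => ⟨⟨γ, h, rfl⟩, fun k => ⟨k, γ, h, rfl⟩⟩

/-- Concatenating signals whose last `l` symbols before switching agree with those of a signal
of `B` having the same continuation stays inside an asynchronously `l`-complete behavior. -/
theorem concat_mem_lift {Γ : Type*} {l : ℕ} {B : Set (ℕ → Γ)} {u v w : ℕ → Γ} {a b c : ℕ}
    (hu : u ∈ lift l B) (hv : concat v w (b + l) c ∈ B) (h : window u a l = window v b l) :
    concat u w (a + l) c ∈ lift l B := by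
  refine ⟨?_, fun k => ?_⟩
  · convert hu.1 using 1
    exact window_eq_window_iff.2 fun i hi => concat_of_lt (by omega)
  · rcases lt_or_ge k a with hk | hk
    · convert hu.2 k using 3
      exact window_eq_window_iff.2 fun i hi => concat_of_lt (by omega)
    · obtain ⟨d, rfl⟩ := Nat.exists_eq_add_of_le hk
      refine ⟨b + d, _, hv, window_eq_window_iff.2 fun i _ => ?_⟩
      simpa only [Nat.add_assoc] using (concat_add_eq_concat_add h (d + i)).symm

theorem initSim_Rl {Γ X : Type*} {l : ℕ} {BS : Set ((ℕ → Γ) × (ℕ → X))}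
    (hBS : IsAsyncSS BS) :
    InitSim l BS (canonBeh l (lift l (extBeh BS))) (Rl l BS (extBeh BS)) := by
  have ext_mem {p} (hp : p ∈ BS) : p.1 ∈ extBeh BS := ⟨p.2, hp⟩
  refine ⟨fun p hp => ?_, ?_⟩
  · have hγ := subset_lift l _ (ext_mem hp)
    refine ⟨(p.1, canonTraj l p.1), mem_canonBeh_iff.2 ⟨hγ, rfl⟩, ?_⟩
    dsimp only
    rw [canonTraj_of_le _ le_rfl, Nat.sub_self]
    exact mem_Rl_window hγ (by simpa using window_mem_reach hp 0 l)
  · rintro p hp ⟨γ, z⟩ hq t₁ t₂ ⟨-, hlen, hreach⟩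
    obtain ⟨hγ, rfl⟩ := mem_canonBeh_iff.1 hq
    dsimp only at hγ hlen hreach ⊢
    obtain ⟨a, rfl⟩ := Nat.exists_eq_add_of_le' (le_of_length_canonTraj hlen)
    obtain ⟨r, hr, b, hx, hw⟩ := exists_of_mem_reach hreach
    rw [hlen, canonTraj_of_le _ (by omega), Nat.add_sub_cancel] at hw
    rw [hlen] at hx
    have hs := hBS r hr p hp _ _ hx
    have hc := concat_mem_lift hγ (ext_mem hs) hw.symm
    refine ⟨(_, canonTraj l _), mem_canonBeh_iff.2 ⟨hc, rfl⟩, rfl,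
      fun t ht => canonTraj_congr fun i hi => concat_of_lt (by omega), fun j _ => ?_⟩
    dsimp only
    rw [canonTraj_of_le _ (by omega), show a + l + j - l = a + j by omega]
    refine mem_Rl_window hc ?_
    have := window_mem_reach hs (b + j) l
    rw [show b + j + l = b + l + j by omega, concat_add] at this
    convert this using 2
    refine window_eq_window_iff.2 fun i _ => ?_
    simpa only [Nat.add_assoc] using concat_add_eq_concat_add hw.symm (j + i)

theorem initSim_inv_Rl {Γ X : Type*} {l : ℕ} {BS : Set ((ℕ → Γ) × (ℕ → X))}
    (hBS : IsAsyncSS BS) (hB : lift l (extBeh BS) ⊆ extBeh BS)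
    (hRX : InitSim l BS BS (RX l BS)) :
    InitSim l (canonBeh l (lift l (extBeh BS))) BS (inv (Rl l BS (extBeh BS))) := by
  refine ⟨?_, ?_⟩
  · rintro ⟨γ, z⟩ hp
    obtain ⟨hγ, rfl⟩ := mem_canonBeh_iff.1 hp
    obtain ⟨x, hx⟩ := hB hγ
    refine ⟨(γ, x), hx, ?_⟩
    change (x l, canonTraj l γ l) ∈ Rl l BS _
    rw [canonTraj_of_le _ le_rfl, Nat.sub_self]
    exact mem_Rl_window hγ (by simpa using window_mem_reach hx 0 l)
  · rintro ⟨γ, z⟩ hp q' hq' t₁ t₂ ⟨-, hlen, hreach⟩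
    obtain ⟨hγ, rfl⟩ := mem_canonBeh_iff.1 hp
    dsimp only at hγ hlen hreach ⊢
    obtain ⟨a, rfl⟩ := Nat.exists_eq_add_of_le' (le_of_length_canonTraj hlen)
    obtain ⟨x, hx⟩ := hB hγ
    rw [canonTraj_of_le _ (by omega), Nat.add_sub_cancel] at hreach
    obtain ⟨q, hq, hq1, hq2, -⟩ := hRX.2 _ hx q' hq' (a + l) t₂
      ⟨_, length_window _ _ _, window_mem_reach hx a l, hreach⟩
    refine ⟨q, hq, hq1, hq2, fun j _ => ?_⟩
    obtain ⟨r, hr, b, hrx, hw⟩ := exists_of_mem_reach hreach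
    rw [length_window] at hrx hw
    have hs := hBS r hr q hq _ _ (hrx.trans (hq2 t₂ le_rfl).symm)
    change (q.2 (t₂ + j), canonTraj l γ (a + l + j)) ∈ Rl l BS _
    rw [canonTraj_of_le _ (by omega), show a + l + j - l = a + j by omega]
    refine mem_Rl_window hγ ?_
    have := window_mem_reach hs (b + j) l
    rw [show b + j + l = b + l + j by omega, concat_add] at this
    convert this using 2
    refine window_eq_window_iff.2 fun i _ => ?_
    rcases lt_or_ge (j + i) l with hi | hi
    · rw [concat_of_lt (by omega), Nat.add_assoc, Nat.add_assoc,
        window_eq_window_iff.1 hw _ hi]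
    · rw [concat_eq_of_le (by omega), hq1, concat_eq_of_le (by omega)]
      congr 1
      omega

end LComplete

/-- if `B = B^{l↑}` and `R_X` is an `l`-initial simulation relation from
`Σ_S` to itself, then `Σ_S` and `Σ_S^{l↑}` are `l`-initially bisimilar. -/
theorem bisimilar_of_lComplete {Γ X : Type*} [Nonempty Γ] (l : ℕ) (hl : 1 ≤ l)
    (BS : Set ((ℕ → Γ) × (ℕ → X))) (hBS : LComplete.IsAsyncSS BS)
    (B : Set (ℕ → Γ)) (hB : B = LComplete.extBeh BS)
    (hBeq : B = LComplete.lift l B)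
    (hRX : LComplete.InitSim l BS BS (LComplete.RX l BS)) :
    ∃ R : Set (X × List Γ),
      LComplete.InitSim l BS (LComplete.canonBeh l (LComplete.lift l B)) R ∧
        LComplete.InitSim l (LComplete.canonBeh l (LComplete.lift l B)) BS
          (LComplete.inv R) := by
  subst hB
  exact ⟨LComplete.Rl l BS (LComplete.extBeh BS), LComplete.initSim_Rl hBS,
    LComplete.initSim_inv_Rl hBS hBeq.ge hRX⟩
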